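/- Let u be a regular functional on ℂ[x] with monic OPS (P_n)_{n≥0}, let k ≥ 1, and set P_n^{[j]}(x) = (d^j/dx^j) P_{n+j}(x)/(n+1)_j for j ≥ 0 (Pochhammer normalization, so P_n^{[0]} = P_n). Suppose there exist complex numbers r_n^{[k]} and s_n^{[k]} such that P_n^{[k−1]} = P_n^{[k]} + r_n^{[k]} P_{n−1}^{[k]} + s_n^{[k]} P_{n−2}^{[k]} for every n ≥ 2, and that (P_n^{[k]})_{n≥0} is a monic OPS (with respect to some functional). Then u is classical: there exist a nonzero polynomial φ of degree ≤ 2 and a polynomial ψ of degree exactly 1 such that D(φu) = ψu. -/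

import Mathlib

open Polynomial

/-- Left multiplication of a linear functional `u` on `ℂ[X]` by a polynomial `φ`:
`⟨φu, p⟩ = ⟨u, φ·p⟩`. -/
noncomputable def pmul (φ : ℂ[X]) (u : ℂ[X] →ₗ[ℂ] ℂ) : ℂ[X] →ₗ[ℂ] ℂ :=
  u ∘ₗ LinearMap.mulLeft ℂ φ

/-- Distributional derivative of a linear functional on `ℂ[X]`: `⟨Du, p⟩ = −⟨u, p′⟩`. -/
noncomputable def fder (u : ℂ[X] →ₗ[ℂ] ℂ) : ℂ[X] →ₗ[ℂ] ℂ :=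
  -(u ∘ₗ (Polynomial.derivative : ℂ[X] →ₗ[ℂ] ℂ[X]))

/-- `(P n)` is a monic orthogonal polynomial sequence for the functional `u`. -/
def IsMonicOPS (u : ℂ[X] →ₗ[ℂ] ℂ) (P : ℕ → ℂ[X]) : Prop :=
  (∀ n, (P n).Monic) ∧ (∀ n, (P n).natDegree = n) ∧
    (∀ m n : ℕ, m ≠ n → u (P m * P n) = 0) ∧ (∀ n, u (P n * P n) ≠ 0)

/-- A functional is nondegenerate on multiples if `A u = 0` forces `A = 0`. -/
def MulInjective (u : ℂ[X] →ₗ[ℂ] ℂ) : Prop := ∀ A : ℂ[X], pmul A u = 0 → A = 0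

/-- All derivatives of order `j` of polynomial multiples of `w` are polynomial multiples of `u`. -/
def DerivMultiples (u : ℂ[X] →ₗ[ℂ] ℂ) (j : ℕ) (w : ℂ[X] →ₗ[ℂ] ℂ) : Prop :=
  ∀ p : ℂ[X], ∃ A : ℂ[X], fder^[j] (pmul p w) = pmul A u

section Functionals

variable (u w z : ℂ[X] →ₗ[ℂ] ℂ) (p q : ℂ[X])

lemma pmul_apply : pmul p u q = u (p * q) := rfl

lemma fder_apply : fder u q = -u (derivative q) := rfl

lemma pmul_pmul : pmul p (pmul q u) = pmul (p * q) u := by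
  apply LinearMap.ext; intro x
  simp only [pmul_apply]
  congr 1
  ring

lemma pmul_one : pmul 1 u = u := by
  apply LinearMap.ext; intro x; simp [pmul_apply]

lemma add_pmul : pmul (p + q) u = pmul p u + pmul q u := by
  apply LinearMap.ext; intro x; simp [pmul_apply, add_mul]

lemma sub_pmul : pmul (p - q) u = pmul p u - pmul q u := by
  apply LinearMap.ext; intro x; simp [pmul_apply, sub_mul]

lemma pmul_C (a : ℂ) : pmul (C a) u = a • u := by
  apply LinearMap.ext; intro x; simp [pmul_apply, ← smul_eq_C_mul]

lemma fder_add : fder (w + z) = fder w + fder z := by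
  apply LinearMap.ext; intro x; simp [fder_apply, add_comm]

lemma fder_smul (a : ℂ) : fder (a • w) = a • fder w := by
  apply LinearMap.ext; intro x; simp [fder_apply]

/-- The Leibniz rule. -/
lemma fder_pmul : fder (pmul p w) = pmul p (fder w) + pmul (derivative p) w := by
  apply LinearMap.ext; intro x
  simp [fder_apply, pmul_apply, derivative_mul]

lemma fder_iterate_add (n : ℕ) : fder^[n] (w + z) = fder^[n] w + fder^[n] z := by
  induction n generalizing w z with
  | zero => rfl
  | succ n ih => simp only [Function.iterate_succ_apply, fder_add, ih]

lemma fder_iterate_smul (n : ℕ) (a : ℂ) : fder^[n] (a • w) = a • fder^[n] w := by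
  induction n generalizing w with
  | zero => rfl
  | succ n ih => simp only [Function.iterate_succ_apply, fder_smul, ih]

lemma fder_iterate_apply (n : ℕ) : fder^[n] w q = (-1) ^ n * w (derivative^[n] q) := by
  induction n generalizing w with
  | zero => simp
  | succ n ih =>
    rw [Function.iterate_succ_apply, ih, fder_apply, ← Function.iterate_succ_apply' derivative]
    ring

lemma fder_iterate_pmul_X (n : ℕ) :
    fder^[n + 1] (pmul X w) = pmul X (fder^[n + 1] w) + ((n : ℂ) + 1) • fder^[n] w := by
  induction n with
  | zero => simp [fder_pmul, pmul_one]
  | succ n ih =>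
    rw [Function.iterate_succ_apply', ih, fder_add, fder_pmul, fder_smul, derivative_X, pmul_one,
      ← Function.iterate_succ_apply' fder, ← Function.iterate_succ_apply' fder]
    push_cast
    module

end Functionals

lemma derivative_surjective_complex : Function.Surjective (derivative : ℂ[X] →ₗ[ℂ] ℂ[X]) := by
  intro p
  induction p using Polynomial.induction_on' with
  | add p q hp hq =>
    obtain ⟨a, rfl⟩ := hp
    obtain ⟨b, rfl⟩ := hq
    exact ⟨a + b, map_add _ _ _⟩
  | monomial n a =>
    refine ⟨monomial (n + 1) (a / (n + 1)), ?_⟩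
    have : (n : ℂ) + 1 ≠ 0 := Nat.cast_add_one_ne_zero n
    rw [derivative_monomial]
    simp [this]

lemma eq_zero_of_fder_eq_zero {w : ℂ[X] →ₗ[ℂ] ℂ} (h : fder w = 0) : w = 0 := by
  apply LinearMap.ext; intro q
  obtain ⟨p, rfl⟩ := derivative_surjective_complex q
  simpa [fder_apply] using LinearMap.congr_fun h p

section Sequences

variable {P : ℕ → ℂ[X]}

lemma mem_of_degree_lt_of_monic_sequence (hm : ∀ n, (P n).Monic) (hd : ∀ n, (P n).natDegree = n)
    (S : Submodule ℂ ℂ[X]) (n : ℕ) (hS : ∀ i < n, P i ∈ S) :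
    ∀ p : ℂ[X], p.degree < n → p ∈ S := by
  induction n with
  | zero =>
    intro p hp
    have : p = 0 := by simpa using hp
    simp [this]
  | succ n ih =>
    intro p hp
    have hlt : (p - p.coeff n • P n).degree < n := by
      rw [degree_lt_iff_coeff_zero]
      intro m hmn
      rcases hmn.eq_or_lt with rfl | hlt
      · have := hm n
        rw [Monic, leadingCoeff, hd] at this
        simp [this]
      · have h1 : p.coeff m = 0 := coeff_eq_zero_of_degree_lt (hp.trans_le (by exact_mod_cast hlt))
        have h2 : (P n).coeff m = 0 := coeff_eq_zero_of_natDegree_lt (by rw [hd]; exact hlt)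
        simp [h1, h2]
    have := S.add_mem (ih (fun i hi => hS i (by omega)) _ hlt)
      (S.smul_mem (p.coeff n) (hS n (by omega)))
    simpa using this

lemma functional_ext_of_monic_sequence (hm : ∀ n, (P n).Monic) (hd : ∀ n, (P n).natDegree = n)
    {w z : ℂ[X] →ₗ[ℂ] ℂ} (h : ∀ n, w (P n) = z (P n)) : w = z := by
  apply LinearMap.ext; intro p
  have := mem_of_degree_lt_of_monic_sequence hm hd (LinearMap.eqLocus w z) (p.natDegree + 1)
    (fun i _ => h i) p (degree_le_natDegree.trans_lt (by exact_mod_cast Nat.lt_succ_self _))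
  exact this

variable {u : ℂ[X] →ₗ[ℂ] ℂ}

lemma IsMonicOPS.apply_mul_eq_zero (h : IsMonicOPS u P) {n : ℕ} {p : ℂ[X]} (hp : p.degree < n) :
    u (p * P n) = 0 := by
  have := mem_of_degree_lt_of_monic_sequence h.1 h.2.1
    (LinearMap.ker (u ∘ₗ LinearMap.mulRight ℂ (P n))) n
    (fun i hi => by simpa using h.2.2.1 i n hi.ne) p hp
  simpa using this

lemma IsMonicOPS.apply_mul_ne_zero (h : IsMonicOPS u P) {p : ℂ[X]} (hp : p ≠ 0) :
    u (p * P p.natDegree) ≠ 0 := by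
  have hP : (P p.natDegree).leadingCoeff = 1 := h.1 _
  have hlt : (p - p.leadingCoeff • P p.natDegree).degree < p.natDegree := by
    rw [degree_lt_iff_coeff_zero]
    intro m hmn
    rcases hmn.eq_or_lt with rfl | hlt
    · rw [leadingCoeff, h.2.1] at hP
      simp [hP]
    · rw [coeff_sub, coeff_eq_zero_of_natDegree_lt hlt, coeff_smul,
        coeff_eq_zero_of_natDegree_lt (by rw [h.2.1]; exact hlt)]
      simp
  have := h.apply_mul_eq_zero hlt
  rw [sub_mul, map_sub, sub_eq_zero, smul_mul_assoc, map_smul] at this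
  rw [this]
  exact mul_ne_zero (leadingCoeff_ne_zero.mpr hp) (h.2.2.2 _)

lemma IsMonicOPS.mulInjective (h : IsMonicOPS u P) : MulInjective u := by
  intro A hA
  by_contra hne
  exact h.apply_mul_ne_zero hne (LinearMap.congr_fun hA _)

lemma IsMonicOPS.exists_eq_pmul (h : IsMonicOPS u P) {w : ℂ[X] →ₗ[ℂ] ℂ} {N : ℕ}
    (hw : ∀ n, N ≤ n → w (P n) = 0) : ∃ φ : ℂ[X], φ.degree < N ∧ w = pmul φ u := by
  refine ⟨∑ i ∈ Finset.range N, (w (P i) / u (P i * P i)) • P i, ?_, ?_⟩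
  · rw [← mem_degreeLT]
    refine Submodule.sum_mem _ fun i hi => Submodule.smul_mem _ _ ?_
    rw [mem_degreeLT, degree_eq_natDegree (h.1 i).ne_zero, h.2.1]
    exact_mod_cast Finset.mem_range.mp hi
  · refine functional_ext_of_monic_sequence h.1 h.2.1 fun n => ?_
    rw [pmul_apply, Finset.sum_mul, map_sum]
    by_cases hn : n < N
    · rw [Finset.sum_eq_single n]
      · simp [div_mul_cancel₀ _ (h.2.2.2 n)]
      · intro b _ hb
        simp [h.2.2.1 b n hb]
      · intro hn'
        exact absurd (Finset.mem_range.mpr hn) hn'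
    · rw [hw n (by omega), Finset.sum_eq_zero]
      intro i hi
      have : i ≠ n := by have := Finset.mem_range.mp hi; omega
      simp [h.2.2.1 i n this]

lemma IsMonicOPS.eq_pmul_single (h : IsMonicOPS u P) {w : ℂ[X] →ₗ[ℂ] ℂ} {N : ℕ}
    (hw : ∀ n, n ≠ N → w (P n) = 0) : w = pmul (C (w (P N) / u (P N * P N)) * P N) u := by
  refine functional_ext_of_monic_sequence h.1 h.2.1 fun n => ?_
  rw [pmul_apply, mul_assoc, ← smul_eq_C_mul, map_smul, smul_eq_mul]
  by_cases hn : n = N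
  · subst hn
    rw [div_mul_cancel₀ _ (h.2.2.2 n)]
  · rw [hw n hn, h.2.2.1 N n (Ne.symm hn), mul_zero]

/-- The members of an orthogonal sequence of index at least `k` have no common root. -/
lemma IsMonicOPS.exists_eval_ne_zero (h : IsMonicOPS u P) (k : ℕ) (c : ℂ) :
    ∃ m, (P (m + k)).eval c ≠ 0 := by
  by_contra! hc
  obtain ⟨q, hq⟩ := dvd_iff_isRoot.mpr (hc 0)
  obtain ⟨q', hq'⟩ := dvd_iff_isRoot.mpr (hc 1)
  rw [zero_add] at hq
  rw [add_comm] at hq'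
  have hXc : (X - C c : ℂ[X]).natDegree = 1 := natDegree_X_sub_C c
  have hq0 : q ≠ 0 := by rintro rfl; exact (h.1 k).ne_zero (by simpa using hq)
  have hq0' : q' ≠ 0 := by rintro rfl; exact (h.1 (k + 1)).ne_zero (by simpa using hq')
  have hd : k = 1 + q.natDegree := by
    have := h.2.1 k
    rw [hq, natDegree_mul (X_sub_C_ne_zero c) hq0, hXc] at this
    exact this.symm
  have hd' : q'.natDegree = k := by
    have := h.2.1 (k + 1)
    rw [hq', natDegree_mul (X_sub_C_ne_zero c) hq0', hXc] at this
    omega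
  have h1 := h.apply_mul_ne_zero hq0'
  rw [hd', hq] at h1
  have h2 : u (q * P (k + 1)) = 0 := h.apply_mul_eq_zero <| by
    rw [degree_eq_natDegree hq0]
    exact_mod_cast (by omega : q.natDegree < k + 1)
  rw [hq'] at h2
  apply h1
  rw [← h2]
  congr 1
  ring

end Sequences

/-- A nonzero polynomial multiple of a nondegenerate functional satisfies no first order equation
`φ Dw = a w` with `φ` of degree at most one and `a` constant. -/
lemma MulInjective.pmul_fder_ne {u : ℂ[X] →ₗ[ℂ] ℂ} (hu : MulInjective u) {A φ : ℂ[X]} (hA : A ≠ 0)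
    (hφ : φ ≠ 0) (hdeg : φ.natDegree ≤ 1) (a : ℂ) :
    pmul φ (fder (pmul A u)) ≠ pmul (C a) (pmul A u) := by
  intro h
  obtain ⟨b, c, rfl⟩ := exists_eq_X_add_C_of_natDegree_le_one hdeg
  generalize hw : pmul A u = w at h
  have hne : ∀ B : ℂ[X], B ≠ 0 → pmul B w ≠ 0 := by
    intro B hB h0
    rw [← hw, pmul_pmul] at h0
    exact mul_ne_zero hB hA (hu _ h0)
  have key : ∀ p : ℂ[X], w ((C b * X + C c) * derivative p) + (b + a) * w p = 0 := by
    intro p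
    have := LinearMap.congr_fun h p
    rw [pmul_apply, fder_apply, pmul_apply, derivative_mul, map_add] at this
    rw [show derivative (C b * X + C c) = C b by simp, ← smul_eq_C_mul b, ← smul_eq_C_mul a,
      map_smul, map_smul, smul_eq_mul, smul_eq_mul] at this
    linear_combination -this
  by_cases hb : b = 0
  · subst hb
    have hc : c ≠ 0 := by rintro rfl; simp at hφ
    have hpow : ∀ n : ℕ, a * w (X ^ (n + 1)) = -(c * (n + 1) * w (X ^ n)) := by
      intro n
      have := key (X ^ (n + 1))
      have h2 : (C 0 * X + C c : ℂ[X]) * derivative (X ^ (n + 1)) = (c * (n + 1)) • X ^ n := by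
        rw [derivative_X_pow, smul_eq_C_mul]
        simp
        ring
      rw [h2, map_smul, smul_eq_mul] at this
      linear_combination this
    refine hne 1 one_ne_zero ?_
    rw [pmul_one]
    refine functional_ext_of_monic_sequence (P := fun n => X ^ n) (fun n => monic_X_pow n)
      (fun n => natDegree_X_pow n) fun n => ?_
    rw [LinearMap.zero_apply]
    by_cases ha : a = 0
    · have := hpow n
      rw [ha, zero_mul, eq_comm, neg_eq_zero] at this
      have hn : (n : ℂ) + 1 ≠ 0 := Nat.cast_add_one_ne_zero n
      simpa [hc, hn] using this
    · induction n with
      | zero => simpa [ha] using key 1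
      | succ n ih =>
        have := hpow n
        rw [ih] at this
        simpa [ha] using this
  · obtain ⟨d, hd⟩ : ∃ d, c = -(b * d) := ⟨-(c / b), by field_simp⟩
    have hpow : ∀ n : ℕ, (b * (n + 1) + (b + a)) * w ((X - C d) ^ (n + 1)) = 0 := by
      intro n
      have := key ((X - C d) ^ (n + 1))
      have h2 : (C b * X + C c : ℂ[X]) * derivative ((X - C d) ^ (n + 1)) =
          (b * (n + 1)) • (X - C d) ^ (n + 1) := by
        rw [derivative_X_sub_C_pow, smul_eq_C_mul, hd]
        simp
        ring
      rw [h2, map_smul, smul_eq_mul] at this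
      linear_combination this
    obtain ⟨N, hN⟩ : ∃ N : ℕ, ∀ n : ℕ, N ≤ n → b * (n + 1) + (b + a) ≠ 0 := by
      by_cases hex : ∃ N : ℕ, b * (N + 1) + (b + a) = 0
      · obtain ⟨N, hN⟩ := hex
        refine ⟨N + 1, fun n hn h0 => ?_⟩
        have h1 : b * ((n : ℂ) - N) = 0 := by linear_combination h0 - hN
        have h2 : (n : ℂ) = N := by simpa [hb, sub_eq_zero] using h1
        have : n = N := by exact_mod_cast h2
        omega
      · push Not at hex
        exact ⟨0, fun n _ => hex n⟩
    refine hne ((X - C d) ^ (N + 1)) (pow_ne_zero _ (X_sub_C_ne_zero d)) ?_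
    refine functional_ext_of_monic_sequence (P := fun n => (X - C d) ^ n)
      (fun n => (monic_X_sub_C d).pow n) (fun n => by simp) fun n => ?_
    rw [LinearMap.zero_apply, pmul_apply, ← pow_add, show N + 1 + n = N + n + 1 by ring]
    exact (mul_eq_zero.mp (hpow (N + n))).resolve_left (hN _ (by omega))

lemma MulInjective.isCoprime {u : ℂ[X] →ₗ[ℂ] ℂ} (hu : MulInjective u) {A B φ ω : ℂ[X]} (hA : A ≠ 0)
    (hφ : φ ≠ 0) (hφd : φ.natDegree ≤ 2) (hω : ω.natDegree ≤ 1)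
    (hB : fder (pmul A u) = pmul B u) (h : φ * B = ω * A) : IsCoprime φ ω := by
  rw [isCoprime_iff_aeval_ne_zero_of_isAlgClosed ℂ ℂ]
  by_contra! hc
  obtain ⟨c, h1, h2⟩ := hc
  obtain ⟨φ₁, rfl⟩ := dvd_iff_isRoot.mpr (by simpa using h1 : φ.IsRoot c)
  obtain ⟨ω₁, rfl⟩ := dvd_iff_isRoot.mpr (by simpa using h2 : ω.IsRoot c)
  have hX : (X - C c : ℂ[X]) ≠ 0 := X_sub_C_ne_zero c
  have hφ₁ : φ₁ ≠ 0 := right_ne_zero_of_mul hφ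
  rw [natDegree_mul hX hφ₁, natDegree_X_sub_C] at hφd
  have hω₁ : ω₁.natDegree = 0 := by
    by_cases h0 : ω₁ = 0
    · simp [h0]
    · rw [natDegree_mul hX h0, natDegree_X_sub_C] at hω
      omega
  obtain ⟨a, rfl⟩ := natDegree_eq_zero.mp hω₁
  refine hu.pmul_fder_ne hA hφ₁ (by omega) a ?_
  rw [hB, pmul_pmul, pmul_pmul]
  congr 1
  apply mul_left_cancel₀ hX
  linear_combination h

section DerivMultiples

variable {u w : ℂ[X] →ₗ[ℂ] ℂ}

lemma DerivMultiples.of_succ {j : ℕ} (h : DerivMultiples u (j + 1) w) : DerivMultiples u j w := by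
  intro p
  obtain ⟨A, hA⟩ := h p
  obtain ⟨B, hB⟩ := h (X * p)
  rw [← pmul_pmul, fder_iterate_pmul_X, hA, pmul_pmul] at hB
  have hj : (j : ℂ) + 1 ≠ 0 := Nat.cast_add_one_ne_zero j
  refine ⟨C ((j : ℂ) + 1)⁻¹ * (B - X * A), ?_⟩
  rw [← pmul_pmul, pmul_C, sub_pmul, ← hB, add_sub_cancel_left, smul_smul, inv_mul_cancel₀ hj,
    one_smul]

lemma DerivMultiples.mono {i j : ℕ} (hij : i ≤ j) (h : DerivMultiples u j w) :
    DerivMultiples u i w := by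
  induction hij with
  | refl => exact h
  | step _ ih => exact ih h.of_succ

/-- If `w = A u` satisfies `D(φ w) = ω w` and enough derivatives of its multiples are multiples of
`u`, then `φ` divides `A` and the quotient satisfies a similar equation. -/
lemma DerivMultiples.exists_factor {A φ ω : ℂ[X]} {j : ℕ} (hu : MulInjective u) (hA : A ≠ 0)
    (hφ : φ ≠ 0) (hφd : φ.natDegree ≤ 2) (hω : (ω - derivative φ).natDegree ≤ 1)
    (heq : fder (pmul φ (pmul A u)) = pmul ω (pmul A u))
    (h : DerivMultiples u (j + 1) (pmul A u)) :
    ∃ A', A' ≠ 0 ∧ A = φ * A' ∧ DerivMultiples u j (pmul A' u) ∧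
      fder (pmul φ (pmul A' u)) = pmul (ω - derivative φ) (pmul A' u) := by
  obtain ⟨B, hB⟩ := h.mono (Nat.succ_le_succ (Nat.zero_le j)) 1
  rw [Function.iterate_one, pmul_one] at hB
  have hmul : φ * B = (ω - derivative φ) * A := by
    rw [fder_pmul, hB, pmul_pmul, pmul_pmul, pmul_pmul, ← add_pmul, ← sub_eq_zero,
      ← sub_pmul] at heq
    linear_combination hu _ heq
  have hcop := hu.isCoprime hA hφ hφd hω hB hmul
  obtain ⟨A', rfl⟩ := hcop.dvd_of_dvd_mul_left (Dvd.intro B hmul)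
  have hBA : B = (ω - derivative φ) * A' := by
    apply mul_left_cancel₀ hφ
    linear_combination hmul
  refine ⟨A', right_ne_zero_of_mul hA, rfl, fun p => ?_, ?_⟩
  · obtain ⟨a, b, hab⟩ := hcop
    have hsplit : pmul p (pmul A' u) = pmul (p * a - derivative (p * b)) (pmul (φ * A') u) +
        fder (pmul (p * b) (pmul (φ * A') u)) := by
      rw [fder_pmul, hB, hBA]
      simp only [pmul_pmul]
      rw [← add_pmul, ← add_pmul]
      congr 1
      linear_combination -(p * A') * hab
    obtain ⟨E, hE⟩ := h.of_succ (p * a - derivative (p * b))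
    obtain ⟨F, hF⟩ := h (p * b)
    refine ⟨E + F, ?_⟩
    rw [hsplit, fder_iterate_add, hE, ← Function.iterate_succ_apply, hF, add_pmul]
  · rw [pmul_pmul, hB, hBA, pmul_pmul]

lemma DerivMultiples.exists_factor_pow {A φ ψ : ℂ[X]} (hu : MulInjective u) (hA : A ≠ 0)
    (hφ : φ ≠ 0) (hφd : φ.natDegree ≤ 2) (hψ : ψ.natDegree ≤ 1)
    (heq : fder (pmul φ (pmul A u)) = pmul ψ (pmul A u)) (i j : ℕ)
    (h : DerivMultiples u (j + i) (pmul A u)) :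
    ∃ A' ω : ℂ[X], A' ≠ 0 ∧ A = φ ^ i * A' ∧ ω.natDegree ≤ 1 ∧ DerivMultiples u j (pmul A' u) ∧
      fder (pmul φ (pmul A' u)) = pmul ω (pmul A' u) := by
  induction i generalizing j with
  | zero => exact ⟨A, ψ, hA, by simp, hψ, h, heq⟩
  | succ i ih =>
    obtain ⟨A₁, ω, hA₁, rfl, hω, hder, heq₁⟩ := ih (j + 1) (by convert h using 1; ring)
    have hω' : (ω - derivative φ).natDegree ≤ 1 :=
      (natDegree_sub_le _ _).trans
        (max_le hω ((natDegree_derivative_le φ).trans (by omega)))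
    obtain ⟨A₂, hA₂, rfl, hder₂, heq₂⟩ := hder.exists_factor hu hA₁ hφ hφd hω' heq₁
    exact ⟨A₂, _, hA₂, by ring, hω', hder₂, heq₂⟩

end DerivMultiples

lemma exists_fder_iterate_pmul_pow {w : ℂ[X] →ₗ[ℂ] ℂ} {φ ω : ℂ[X]}
    (heq : fder (pmul φ w) = pmul ω w) (k : ℕ) (p : ℂ[X]) :
    ∃ E, fder^[k] (pmul (p * φ ^ k) w) = pmul E w := by
  induction k generalizing p with
  | zero => exact ⟨p, by simp⟩
  | succ k ih =>
    obtain ⟨E, hE⟩ := ih (derivative p * φ + p * k * derivative φ + p * ω)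
    refine ⟨E, ?_⟩
    rw [Function.iterate_succ_apply, ← hE, pow_succ, ← mul_assoc, ← pmul_pmul, fder_pmul, heq,
      pmul_pmul, pmul_pmul, ← add_pmul]
    congr 2
    cases k with
    | zero => simp; ring
    | succ k => simp [derivative_pow_succ]; ring

/-- A regular functional `v` whose orthogonal polynomials are combinations of at most three
consecutive derivatives satisfies a Pearson equation. -/
lemma IsMonicOPS.exists_pearson {v : ℂ[X] →ₗ[ℂ] ℂ} {Q : ℕ → ℂ[X]} (h : IsMonicOPS v Q)
    (r s : ℕ → ℂ) (hrel : ∀ n : ℕ, ((n : ℂ) + 3 + 1) • Q (n + 3) = derivative (Q (n + 4)) +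
      r n • derivative (Q (n + 3)) + s n • derivative (Q (n + 2))) :
    ∃ φ : ℂ[X], φ ≠ 0 ∧ φ.natDegree ≤ 2 ∧ fder (pmul φ v) = pmul (Q 1) v := by
  obtain ⟨I, hI⟩ := LinearMap.exists_rightInverse_of_surjective
    (derivative : ℂ[X] →ₗ[ℂ] ℂ[X]) (LinearMap.range_eq_top.mpr derivative_surjective_complex)
  have hQ0 : Q 0 = 1 := eq_one_of_monic_natDegree_zero (h.1 0) (h.2.1 0)
  set w : ℂ[X] →ₗ[ℂ] ℂ := -(pmul (Q 1) v ∘ₗ I) with hw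
  have hder : ∀ p, w (derivative p) = -v (Q 1 * p) := by
    intro p
    have h1 : derivative (I (derivative p)) = derivative p := LinearMap.congr_fun hI _
    have h2 : derivative (I (derivative p) - p) = 0 := by rw [derivative_sub, h1, sub_self]
    obtain ⟨c, hc⟩ := natDegree_eq_zero.mp (derivative_eq_zero.mp h2)
    have h3 : v (Q 1) = 0 := by simpa [hQ0] using h.2.2.1 1 0 one_ne_zero
    have h4 : v (Q 1 * C c) = 0 := by
      rw [mul_comm, ← smul_eq_C_mul, map_smul, h3, smul_zero]
    rw [hc, mul_sub, map_sub, sub_eq_zero] at h4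
    simp [hw, pmul_apply, h4]
  have hfw : fder w = pmul (Q 1) v := by
    apply LinearMap.ext; intro p
    rw [fder_apply, hder, neg_neg, pmul_apply]
  have hvan : ∀ n, 3 ≤ n → w (Q n) = 0 := by
    intro n hn
    obtain ⟨m, rfl⟩ := Nat.exists_eq_add_of_le' hn
    have := congrArg w (hrel m)
    simp only [map_add, map_smul, hder, smul_eq_mul] at this
    rw [h.2.2.1 1 (m + 4) (by omega), h.2.2.1 1 (m + 3) (by omega),
      h.2.2.1 1 (m + 2) (by omega)] at this
    have hm : (m : ℂ) + 3 + 1 ≠ 0 := by exact_mod_cast (Nat.succ_ne_zero (m + 3))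
    simpa [hm] using this
  obtain ⟨φ, hφ, hφw⟩ := h.exists_eq_pmul hvan
  have hφ0 : φ ≠ 0 := by
    rintro rfl
    have hz : pmul (Q 1) v = 0 := by
      rw [← hfw, hφw]
      apply LinearMap.ext; intro p
      simp [fder_apply, pmul_apply]
    exact (h.1 1).ne_zero (h.mulInjective _ hz)
  refine ⟨φ, hφ0, ?_, hφw ▸ hfw⟩
  rw [degree_eq_natDegree hφ0] at hφ
  have : φ.natDegree < 3 := by exact_mod_cast hφ
  omega

lemma IsMonicOPS.degree_eq_one_of_pearson {u : ℂ[X] →ₗ[ℂ] ℂ} {P : ℕ → ℂ[X]} (h : IsMonicOPS u P)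
    {φ ω : ℂ[X]} (hφ : φ ≠ 0) (hω : ω.natDegree ≤ 1) (heq : fder (pmul φ u) = pmul ω u) :
    ω.degree = 1 := by
  have hP0 : P 0 = 1 := eq_one_of_monic_natDegree_zero (h.1 0) (h.2.1 0)
  have hu1 : u 1 ≠ 0 := by simpa [hP0] using h.2.2.2 0
  rw [← Nat.cast_one, degree_eq_iff_natDegree_eq_of_pos one_pos]
  by_contra hne
  obtain ⟨a, rfl⟩ := natDegree_eq_zero.mp (by omega : ω.natDegree = 0)
  have h1 := LinearMap.congr_fun heq 1
  rw [fder_apply, pmul_C] at h1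
  have ha : a = 0 := by simpa [hu1] using h1
  rw [ha, pmul_C, zero_smul] at heq
  exact hφ (h.mulInjective _ (eq_zero_of_fder_eq_zero heq))

/-- If the normalized `k`-th derivatives of `P` are orthogonal for `v`, then `D^k (Q_m v)` is a
nonzero multiple of `P_{m+k} u`. -/
lemma IsMonicOPS.exists_fder_iterate_eq {u v : ℂ[X] →ₗ[ℂ] ℂ} {P Q : ℕ → ℂ[X]} {k : ℕ}
    {a : ℕ → ℂ} (hP : IsMonicOPS u P) (hQ : IsMonicOPS v Q) (ha : ∀ n, a n ≠ 0)
    (hder : ∀ n, derivative^[k] (P (n + k)) = a n • Q n) (m : ℕ) :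
    ∃ c : ℂ, c ≠ 0 ∧ fder^[k] (pmul (Q m) v) = pmul (C c * P (m + k)) u := by
  have happ : ∀ n, fder^[k] (pmul (Q m) v) (P (n + k)) = (-1) ^ k * (a n * v (Q m * Q n)) := by
    intro n
    rw [fder_iterate_apply, hder, pmul_apply, mul_smul_comm, map_smul, smul_eq_mul]
  refine ⟨_, ?_, hP.eq_pmul_single fun n hn => ?_⟩
  · rw [happ]
    exact div_ne_zero (mul_ne_zero (pow_ne_zero _ (by norm_num))
      (mul_ne_zero (ha m) (hQ.2.2.2 m))) (hP.2.2.2 _)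
  · rcases lt_or_ge n k with hlt | hge
    · rw [fder_iterate_apply, iterate_derivative_eq_zero (by rwa [hP.2.1]), map_zero, mul_zero]
    · obtain ⟨l, rfl⟩ := Nat.exists_eq_add_of_le' hge
      rw [happ, hQ.2.2.1 m l (by omega), mul_zero, mul_zero]

lemma derivMultiples_of_monic_sequence {u v : ℂ[X] →ₗ[ℂ] ℂ} {Q : ℕ → ℂ[X]}
    (hm : ∀ n, (Q n).Monic) (hd : ∀ n, (Q n).natDegree = n) {k : ℕ}
    (h : ∀ m, ∃ A, fder^[k] (pmul (Q m) v) = pmul A u) : DerivMultiples u k v := by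
  let S : Submodule ℂ ℂ[X] :=
    { carrier := {p | ∃ A, fder^[k] (pmul p v) = pmul A u}
      zero_mem' := ⟨0, by
        rw [← C_0, pmul_C, pmul_C, fder_iterate_smul, zero_smul, zero_smul]⟩
      add_mem' := by
        rintro p q ⟨A, hA⟩ ⟨B, hB⟩
        exact ⟨A + B, by rw [add_pmul, fder_iterate_add, hA, hB, add_pmul]⟩
      smul_mem' := by
        rintro c p ⟨A, hA⟩
        exact ⟨C c * A, by
          rw [smul_eq_C_mul, ← pmul_pmul, pmul_C, fder_iterate_smul, hA, ← pmul_pmul, pmul_C]⟩ }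
  intro p
  exact mem_of_degree_lt_of_monic_sequence hm hd S (p.natDegree + 1) (fun i _ => h i) p
    (degree_le_natDegree.trans_lt (by exact_mod_cast Nat.lt_succ_self _))

/-- If the normalized `k`-th derivatives of an orthogonal sequence are orthogonal for a functional
satisfying a Pearson equation, then the original functional satisfies one as well. -/
lemma IsMonicOPS.exists_pearson_of_derivatives {u v : ℂ[X] →ₗ[ℂ] ℂ} {P Q : ℕ → ℂ[X]} {k : ℕ}
    {a : ℕ → ℂ} (hP : IsMonicOPS u P) (hQ : IsMonicOPS v Q) (ha : ∀ n, a n ≠ 0)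
    (hder : ∀ n, derivative^[k] (P (n + k)) = a n • Q n) {φ ψ : ℂ[X]} (hφ : φ ≠ 0)
    (hφd : φ.natDegree ≤ 2) (hψ : ψ.natDegree ≤ 1) (heq : fder (pmul φ v) = pmul ψ v) :
    ∃ ω : ℂ[X], ω.natDegree ≤ 1 ∧ fder (pmul φ u) = pmul ω u := by
  have hu := hP.mulInjective
  choose c hc hcder using hP.exists_fder_iterate_eq hQ ha hder
  have hmult : DerivMultiples u k v :=
    derivMultiples_of_monic_sequence hQ.1 hQ.2.1 fun m => ⟨_, hcder m⟩
  obtain ⟨A, hA⟩ := hmult.mono (Nat.zero_le k) 1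
  rw [Function.iterate_zero_apply, pmul_one] at hA
  subst hA
  have hA0 : A ≠ 0 := by
    rintro rfl
    apply hQ.2.2.2 0
    simp [pmul_apply]
  obtain ⟨A', ω, hA', rfl, hω, -, heq'⟩ := DerivMultiples.exists_factor_pow hu hA0 hφ hφd hψ heq
    k 0 (by rwa [zero_add])
  have hdvd : ∀ m, A' ∣ P (m + k) := by
    intro m
    obtain ⟨E, hE⟩ := exists_fder_iterate_pmul_pow heq' k (Q m)
    have h1 := hcder m
    rw [pmul_pmul, ← mul_assoc, ← pmul_pmul, hE, pmul_pmul, eq_comm, ← sub_eq_zero,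
      ← sub_pmul] at h1
    have h2 : A' ∣ C (c m) * P (m + k) := ⟨E, by linear_combination hu _ h1⟩
    exact (IsUnit.dvd_mul_left (isUnit_C.mpr (hc m).isUnit)).mp h2
  have hconst : A'.degree = 0 := by
    by_contra hne
    obtain ⟨z, hz⟩ := IsAlgClosed.exists_root A' hne
    obtain ⟨m, hm⟩ := hP.exists_eval_ne_zero k z
    exact hm (hz.dvd (hdvd m))
  rw [eq_C_of_degree_eq_zero hconst] at heq' hA'
  have h0 : A'.coeff 0 ≠ 0 := by simpa using hA'
  refine ⟨ω, hω, ?_⟩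
  rw [pmul_pmul, pmul_pmul, mul_comm, mul_comm ω, ← pmul_pmul, ← pmul_pmul, pmul_C, pmul_C,
    fder_smul] at heq'
  exact smul_right_injective _ h0 heq'

/-- if `u` is regular with monic OPS `(P n)`, `k ≥ 1`, the normalized
derivatives `P_n^{[j]} = (d^j/dx^j)P_{n+j}/(n+1)_j` satisfy
`P_n^{[k−1]} = P_n^{[k]} + r_n P_{n−1}^{[k]} + s_n P_{n−2}^{[k]}` for all `n ≥ 2`, and
`(P_n^{[k]})` is a monic OPS with respect to some functional, then `u` is classical:
`D(φu) = ψu` for some nonzero `φ` of degree ≤ 2 and `ψ` of degree exactly 1. -/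
theorem stmt17 (u : ℂ[X] →ₗ[ℂ] ℂ) (P : ℕ → ℂ[X]) (hOPS : IsMonicOPS u P)
    (k : ℕ) (hk : 1 ≤ k)
    (Pk : ℕ → ℕ → ℂ[X])
    (hPk : ∀ j n, Pk j n =
      (∏ i ∈ Finset.range j, ((n : ℂ) + 1 + (i : ℂ)))⁻¹ • derivative^[j] (P (n + j)))
    (r s : ℕ → ℂ)
    (hrel : ∀ n : ℕ, 2 ≤ n →
      Pk (k - 1) n = Pk k n + C (r n) * Pk k (n - 1) + C (s n) * Pk k (n - 2))
    (hOPSk : ∃ v : ℂ[X] →ₗ[ℂ] ℂ, IsMonicOPS v (Pk k)) :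
    ∃ φ ψ : ℂ[X], φ ≠ 0 ∧ φ.degree ≤ 2 ∧ ψ.degree = 1 ∧
      fder (pmul φ u) = pmul ψ u := by
  obtain ⟨v, hv⟩ := hOPSk
  obtain ⟨l, rfl⟩ := Nat.exists_eq_add_of_le' hk
  rw [Nat.add_sub_cancel] at hrel
  have hprod : ∀ j n : ℕ, (∏ i ∈ Finset.range j, ((n : ℂ) + 1 + (i : ℂ))) ≠ 0 := by
    intro j n
    refine Finset.prod_ne_zero_iff.mpr fun i _ => ?_
    exact_mod_cast (by omega : n + 1 + i ≠ 0)
  have hder : ∀ n, derivative^[l + 1] (P (n + (l + 1))) =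
      (∏ i ∈ Finset.range (l + 1), ((n : ℂ) + 1 + (i : ℂ))) • Pk (l + 1) n := by
    intro n
    rw [hPk, smul_smul, mul_inv_cancel₀ (hprod _ _), one_smul]
  have hstep : ∀ n : ℕ, derivative (Pk l (n + 1)) = ((n : ℂ) + 1) • Pk (l + 1) n := by
    intro n
    have hn : (n : ℂ) + 1 ≠ 0 := Nat.cast_add_one_ne_zero n
    rw [hPk l, hPk (l + 1), derivative_smul, ← Function.iterate_succ_apply' derivative, smul_smul,
      show n + 1 + l = n + (l + 1) by ring, Finset.prod_range_succ']
    congr 1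
    simp only [Nat.cast_zero, add_zero, mul_inv]
    rw [mul_comm, mul_assoc, inv_mul_cancel₀ hn, mul_one]
    congr 1
    refine Finset.prod_congr rfl fun i _ => ?_
    push_cast
    ring
  obtain ⟨φ, hφ, hφd, heq⟩ := hv.exists_pearson (fun n => r (n + 4)) (fun n => s (n + 4)) <| by
    intro n
    have h1 := congrArg derivative (hrel (n + 4) (by omega))
    rw [hstep (n + 3)] at h1
    simpa [← smul_eq_C_mul] using h1
  obtain ⟨ω, hω, hωeq⟩ := hOPS.exists_pearson_of_derivatives hv (hprod (l + 1)) hder hφ hφd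
    (hv.2.1 1).le heq
  exact ⟨φ, ω, hφ, degree_le_of_natDegree_le hφd, hOPS.degree_eq_one_of_pearson hφ hω hωeq, hωeq⟩
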